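/- arXiv:2407.20659 — 9 statements merged into one kernel-verified Lean document; each statement's English description precedes it below -/
import Mathlib

section
/- Let d ≥ 1, and for each k ∈ {1,…,d} let Γ_k ⊆ ℝ be a finite nonempty set of grid coordinates. Let s = ∏_{k=1}^d [l_k, r_k] be a closed axis-aligned box that is stabbed along every axis, i.e., for each k there exists γ ∈ Γ_k with l_k ≤ γ ≤ r_k. If s intersects a grid cell C, then s contains a corner of C, i.e., there is a point q ∈ s such that for every k the coordinate q_k is a finite endpoint (an element of Γ_k) of the k-th column of C. -/
/-- Two reals lie in the same grid column determined by the finite set `Γ` of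
grid coordinates `γ₁ < ⋯ < γₘ` (the columns are the half-open intervals
`(-∞,γ₁), [γ₁,γ₂), …, [γₘ,∞)`, which partition `ℝ`): this holds exactly when
every grid coordinate lies on the same side of both points. -/
def SameCol (Γ : Finset ℝ) (x y : ℝ) : Prop := ∀ γ ∈ Γ, (γ ≤ x ↔ γ ≤ y)

/-- `e` is a finite endpoint (an element of `Γ`) of the column, w.r.t. the grid
coordinates `Γ`, containing `x`: either the greatest grid coordinate `≤ x`
(the left endpoint of the column) or the least grid coordinate `> x`
(the right endpoint of the column). -/
def IsColEndpoint (Γ : Finset ℝ) (x e : ℝ) : Prop :=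
  e ∈ Γ ∧ ((e ≤ x ∧ ∀ γ ∈ Γ, γ ≤ x → γ ≤ e) ∨ (x < e ∧ ∀ γ ∈ Γ, x < γ → e ≤ γ))

/-- Points of the same column have the same column endpoints. -/
theorem IsColEndpoint.of_sameCol {Γ : Finset ℝ} {x y e : ℝ} (h : IsColEndpoint Γ x e)
    (hxy : SameCol Γ x y) : IsColEndpoint Γ y e := by
  obtain ⟨he, ⟨hex, hmax⟩ | ⟨hxe, hmin⟩⟩ := h
  · exact ⟨he, Or.inl ⟨(hxy e he).1 hex, fun γ hγ hγy => hmax γ hγ ((hxy γ hγ).2 hγy)⟩⟩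
  · refine ⟨he, Or.inr ⟨?_, fun γ hγ hyγ => hmin γ hγ ?_⟩⟩
    · exact not_le.1 fun hey => hxe.not_ge ((hxy e he).2 hey)
    · exact not_le.1 fun hγx => hyγ.not_ge ((hxy γ hγ).1 hγx)

/-- An interval that contains a grid coordinate contains an endpoint of the column of each of its
points. -/
theorem exists_isColEndpoint_mem_Icc {Γ : Finset ℝ} {l r x : ℝ}
    (hstab : ∃ γ ∈ Γ, l ≤ γ ∧ γ ≤ r) (hx : l ≤ x ∧ x ≤ r) :
    ∃ e, (l ≤ e ∧ e ≤ r) ∧ IsColEndpoint Γ x e := by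
  obtain ⟨γ, hγ, hlγ, hγr⟩ := hstab
  rcases le_or_gt γ x with hγx | hxγ
  · obtain ⟨e, he, hmax⟩ := (Γ.filter (· ≤ x)).exists_max_image id
      ⟨γ, Finset.mem_filter.2 ⟨hγ, hγx⟩⟩
    obtain ⟨heΓ, hex⟩ := Finset.mem_filter.1 he
    exact ⟨e, ⟨hlγ.trans (hmax γ (Finset.mem_filter.2 ⟨hγ, hγx⟩)), hex.trans hx.2⟩, heΓ,
      Or.inl ⟨hex, fun δ hδ hδx => hmax δ (Finset.mem_filter.2 ⟨hδ, hδx⟩)⟩⟩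
  · obtain ⟨e, he, hmin⟩ := (Γ.filter (x < ·)).exists_min_image id
      ⟨γ, Finset.mem_filter.2 ⟨hγ, hxγ⟩⟩
    obtain ⟨heΓ, hxe⟩ := Finset.mem_filter.1 he
    exact ⟨e, ⟨hx.1.trans hxe.le, (hmin γ (Finset.mem_filter.2 ⟨hγ, hxγ⟩)).trans hγr⟩, heΓ,
      Or.inr ⟨hxe, fun δ hδ hxδ => hmin δ (Finset.mem_filter.2 ⟨hδ, hxδ⟩)⟩⟩

/-- If a closed axis-aligned box `s = ∏ₖ [l k, r k]` in `ℝ^d` that is stabbed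
along every axis by the grid coordinates `Γ k` intersects the grid cell
containing the point `p` (the intersection being witnessed by `x`), then `s`
contains a corner `q` of that cell. -/
theorem stmt0 (d : ℕ) (hd : 1 ≤ d) (Γ : Fin d → Finset ℝ) (hΓ : ∀ k, (Γ k).Nonempty)
    (l r : Fin d → ℝ)
    (hstab : ∀ k, ∃ γ ∈ Γ k, l k ≤ γ ∧ γ ≤ r k)
    (p x : Fin d → ℝ)
    (hxs : ∀ k, l k ≤ x k ∧ x k ≤ r k)
    (hxC : ∀ k, SameCol (Γ k) (x k) (p k)) :
    ∃ q : Fin d → ℝ, (∀ k, l k ≤ q k ∧ q k ≤ r k) ∧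
      ∀ k, IsColEndpoint (Γ k) (p k) (q k) := by
  choose q hq hqx using fun k => exists_isColEndpoint_mem_Icc (hstab k) (hxs k)
  exact ⟨q, hq, fun k => (hqx k).of_sameCol (hxC k)⟩
end

section
/- Let S be a finite set with a weight function w : S → ℝ_{≥0}. Let C and R be disjoint finite sets, and let a, b : S → C and c, d : S → R be functions such that a(s) ≠ b(s) and c(s) ≠ d(s) for every s ∈ S. Then there exists a subset Z ⊆ C ∪ R such that the total weight of the elements s ∈ S satisfying a(s) ∈ Z, b(s) ∉ Z, c(s) ∈ Z and d(s) ∉ Z is at least (1/16)·Σ_{s∈S} w(s). -/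
/-- The subsets of `C` that contain `x` but not `y` make up a quarter of all subsets. -/
theorem card_powerset_filter_mem_notMem {α : Type*} [DecidableEq α] {C : Finset α} {x y : α}
    (hx : x ∈ C) (hy : y ∈ C) (hxy : x ≠ y) :
    4 * (C.powerset.filter (fun Z => x ∈ Z ∧ y ∉ Z)).card = C.powerset.card := by
  have hIcc : C.powerset.filter (fun Z => x ∈ Z ∧ y ∉ Z) = Finset.Icc {x} (C.erase y) := by
    ext Z
    simp only [Finset.mem_filter, Finset.mem_powerset, Finset.mem_Icc,
      Finset.singleton_subset_iff, Finset.subset_erase]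
    tauto
  have hle : ({x} : Finset α) ⊆ C.erase y := by simp [hx, hxy]
  have hcard : 2 ≤ C.card := Finset.one_lt_card.2 ⟨x, hx, y, hy, hxy⟩
  obtain ⟨n, hn⟩ := Nat.exists_eq_add_of_le hcard
  rw [hIcc, Finset.card_Icc_finset hle, Finset.card_erase_of_mem hy, Finset.card_powerset,
    Finset.card_singleton, hn, show 2 + n - 1 - 1 = n by omega, pow_add]
  norm_num

/-- Every weighted directed multigraph without loops has a directed cut carrying at least a
quarter of the total weight. -/
theorem exists_subset_quarter_le_dicut {α β : Type*} [DecidableEq α] (C : Finset α)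
    (S : Finset β) (w : β → ℝ) (a b : β → α) (ha : ∀ s ∈ S, a s ∈ C) (hb : ∀ s ∈ S, b s ∈ C)
    (hab : ∀ s ∈ S, a s ≠ b s) :
    ∃ Z ⊆ C, (1 / 4 : ℝ) * ∑ s ∈ S, w s ≤ ∑ s ∈ S.filter (fun s => a s ∈ Z ∧ b s ∉ Z), w s := by
  have hsum : ∑ _Z ∈ C.powerset, (1 / 4 : ℝ) * ∑ s ∈ S, w s ≤
      ∑ Z ∈ C.powerset, ∑ s ∈ S.filter (fun s => a s ∈ Z ∧ b s ∉ Z), w s := by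
    simp_rw [Finset.sum_filter]
    rw [Finset.sum_comm, Finset.sum_const, nsmul_eq_mul, Finset.mul_sum, Finset.mul_sum]
    refine (Finset.sum_congr rfl fun s hs => ?_).le
    rw [← Finset.sum_filter, Finset.sum_const, nsmul_eq_mul,
      ← card_powerset_filter_mem_notMem (ha s hs) (hb s hs) (hab s hs)]
    push_cast
    ring
  obtain ⟨Z, hZ, h⟩ := Finset.exists_le_of_sum_le ⟨∅, Finset.empty_mem_powerset C⟩ hsum
  exact ⟨Z, Finset.mem_powerset.1 hZ, h⟩

/-- Combinatorial core of the alternative rounding proof for independent sets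
of rectangles: given disjoint finite sets `C` (columns) and `R` (rows), a
finite weighted family `S`, and maps `a b : S → C`, `c d : S → R` with
`a s ≠ b s` and `c s ≠ d s`, there is a subset `Z ⊆ C ∪ R` such that the
elements `s` with `a s ∈ Z`, `b s ∉ Z`, `c s ∈ Z`, `d s ∉ Z` carry at least a
`1/16` fraction of the total weight. -/
theorem stmt3 {α β : Type*} [DecidableEq α] (C R : Finset α) (hCR : Disjoint C R)
    (S : Finset β) (w : β → ℝ) (hw : ∀ s ∈ S, 0 ≤ w s)
    (a b c d : β → α)
    (haC : ∀ s ∈ S, a s ∈ C) (hbC : ∀ s ∈ S, b s ∈ C)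
    (hcR : ∀ s ∈ S, c s ∈ R) (hdR : ∀ s ∈ S, d s ∈ R)
    (hab : ∀ s ∈ S, a s ≠ b s) (hcd : ∀ s ∈ S, c s ≠ d s) :
    ∃ Z ⊆ C ∪ R,
      (1 / 16 : ℝ) * ∑ s ∈ S, w s ≤
        ∑ s ∈ S.filter (fun s => a s ∈ Z ∧ b s ∉ Z ∧ c s ∈ Z ∧ d s ∉ Z), w s := by
  obtain ⟨X, hX, hXw⟩ := exists_subset_quarter_le_dicut C S w a b haC hbC hab
  obtain ⟨Y, hY, hYw⟩ := exists_subset_quarter_le_dicut R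
    (S.filter (fun s => a s ∈ X ∧ b s ∉ X)) w c d
    (fun s hs => hcR s (Finset.mem_of_mem_filter s hs))
    (fun s hs => hdR s (Finset.mem_of_mem_filter s hs))
    (fun s hs => hcd s (Finset.mem_of_mem_filter s hs))
  refine ⟨X ∪ Y, Finset.union_subset_union hX hY, ?_⟩
  have hfilter : S.filter (fun s => a s ∈ X ∪ Y ∧ b s ∉ X ∪ Y ∧ c s ∈ X ∪ Y ∧ d s ∉ X ∪ Y) =
      (S.filter (fun s => a s ∈ X ∧ b s ∉ X)).filter (fun s => c s ∈ Y ∧ d s ∉ Y) := by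
    rw [Finset.filter_filter]
    refine Finset.filter_congr fun s hs => ?_
    have haY : a s ∉ Y := fun h => Finset.disjoint_left.1 hCR (haC s hs) (hY h)
    have hbY : b s ∉ Y := fun h => Finset.disjoint_left.1 hCR (hbC s hs) (hY h)
    have hcX : c s ∉ X := fun h => Finset.disjoint_left.1 hCR (hX h) (hcR s hs)
    have hdX : d s ∉ X := fun h => Finset.disjoint_left.1 hCR (hX h) (hdR s hs)
    simp only [Finset.mem_union]
    tauto
  rw [hfilter]
  linarith
end

section
/- Let G = (V,E) be a finite simple graph with |V| = n ≥ 2, let δ > 0 and z > 0, and let x* : V → [0,1] be a fractional vertex cover of G of size Σ_{v∈V} x*_v = z* > 0. Suppose z ≥ (1+δ)z*. Let e_1, …, e_t be a sequence of edges of G, and for 0 ≤ i ≤ t and v ∈ V define c_i(v) = #{j ≤ i : v is an endpoint of e_j}, w_i(v) = (1+δ)^{c_i(v)}, and W_i = Σ_{v∈V} w_i(v). Suppose that for every i ∈ {1,…,t}, writing e_i = {u,v}, we have w_{i−1}(u) + w_{i−1}(v) < W_{i−1}/z. Then t ≤ z*·(ln n)/(ln(1+δ) − δ/(1+δ)). 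-/
open Finset

/-- The number of indices below `i + 1` satisfying `p`, in terms of the number below `i`. -/
lemma card_filter_val_lt_succ {t : ℕ} (p : Fin t → Prop) [DecidablePred p] (i : Fin t) :
    ((univ : Finset (Fin t)).filter (fun j => j.val < i.val + 1 ∧ p j)).card
      = ((univ : Finset (Fin t)).filter (fun j => j.val < i.val ∧ p j)).card
        + if p i then 1 else 0 := by
  simp only [card_filter]
  have hi : (if p i then 1 else 0) = ∑ j, if j = i then (if p j then 1 else 0) else 0 := by simp
  rw [hi, ← sum_add_distrib]
  refine sum_congr rfl fun j _ => ?_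
  by_cases hj : j = i
  · subst hj
    simp
  · have hne : j.val ≠ i.val := fun h => hj (Fin.ext h)
    have hiff : j.val < i.val + 1 ↔ j.val < i.val := by omega
    simp [hj, hiff]

/-- Summing `f` over the endpoints of a pair of distinct vertices. -/
lemma sum_ite_eq_or_eq {V : Type*} [Fintype V] [DecidableEq V] {a b : V} (hab : a ≠ b)
    (f : V → ℝ) : ∑ v, (if a = v ∨ b = v then f v else 0) = f a + f b := by
  have h : ∀ v, (if a = v ∨ b = v then f v else 0)
      = (if a = v then f v else 0) + (if b = v then f v else 0) := by
    intro v
    by_cases h1 : a = v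
    · have h2 : b ≠ v := fun h => hab (h1.trans h.symm)
      simp [h1, h2]
    · simp [h1]
  simp [h, sum_add_distrib]

/-- `x / (1 + x) < log (1 + x)` for positive `x`. -/
lemma div_one_add_lt_log_one_add {x : ℝ} (hx : 0 < x) : x / (1 + x) < Real.log (1 + x) := by
  have h := Real.log_lt_sub_one_of_pos (x := (1 + x)⁻¹) (by positivity)
    (inv_ne_one.mpr (by linarith))
  rw [Real.log_inv] at h
  have h2 : x / (1 + x) = 1 - (1 + x)⁻¹ := by field_simp; ring
  linarith

/-- A fractional vertex cover of a simple graph `G`: a function `x : V → [0,1]`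
with `x u + x v ≥ 1` for every edge `uv` of `G`. -/
def IsFracVC {V : Type*} (G : SimpleGraph V) (x : V → ℝ) : Prop :=
  (∀ v, 0 ≤ x v ∧ x v ≤ 1) ∧ ∀ u v, G.Adj u v → 1 ≤ x u + x v

/-- Termination analysis of the MWU algorithm for fractional vertex cover:
if `G` has a fractional vertex cover `x*` of size `z* > 0`, `z ≥ (1+δ)z*`, and
`e 0, …, e (t-1)` is a sequence of edges such that, with `c i v` counting how
often `v` is an endpoint among the first `i` edges, `w i v = (1+δ)^(c i v)` and
`W i = Σ_v w i v`, every selected edge `e j` satisfies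
`w j (e j).1 + w j (e j).2 < W j / z`, then
`t ≤ z*·(ln n)/(ln(1+δ) − δ/(1+δ))`, where `n = |V|`. -/
theorem stmt6 {V : Type*} [Fintype V] [DecidableEq V] (G : SimpleGraph V)
    (hn : 2 ≤ Fintype.card V)
    (δ z zstar : ℝ) (hδ : 0 < δ) (hz : 0 < z)
    (xstar : V → ℝ) (hxstar : IsFracVC G xstar)
    (hsize : ∑ v, xstar v = zstar) (hzstar : 0 < zstar)
    (hzz : (1 + δ) * zstar ≤ z)
    (t : ℕ) (e : Fin t → V × V) (he : ∀ j, G.Adj (e j).1 (e j).2)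
    (c : ℕ → V → ℕ)
    (hc : ∀ i v, c i v = ((univ : Finset (Fin t)).filter
      (fun j : Fin t => j.val < i ∧ ((e j).1 = v ∨ (e j).2 = v))).card)
    (w : ℕ → V → ℝ) (hw : ∀ i v, w i v = (1 + δ) ^ (c i v))
    (W : ℕ → ℝ) (hW : ∀ i, W i = ∑ v, w i v)
    (hstep : ∀ j : Fin t, w (j : ℕ) (e j).1 + w (j : ℕ) (e j).2 < W (j : ℕ) / z) :
    (t : ℝ) ≤ zstar * Real.log (Fintype.card V) / (Real.log (1 + δ) - δ / (1 + δ)) := by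
  have hδ1 : (0 : ℝ) < 1 + δ := by linarith
  have hwpos : ∀ i v, 0 < w i v := fun i v => by rw [hw]; positivity
  have hWstep : ∀ j : Fin t, W (j + 1) ≤ W j * (1 + δ / z) := by
    intro j
    have hstep_w : ∀ v, w (j + 1) v
        = w j v + δ * (if (e j).1 = v ∨ (e j).2 = v then w j v else 0) := by
      intro v
      rw [hw, hw, hc, hc, card_filter_val_lt_succ (fun j => (e j).1 = v ∨ (e j).2 = v) j]
      split_ifs <;> ring
    have hWsucc : W (j + 1) = W j + δ * (w j (e j).1 + w j (e j).2) := by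
      rw [hW, hW, sum_congr rfl fun v _ => hstep_w v, sum_add_distrib, ← mul_sum,
        sum_ite_eq_or_eq (he j).ne]
    have hmul := mul_le_mul_of_nonneg_left (hstep j).le hδ.le
    have hring : W j * (1 + δ / z) = W j + δ * (W j / z) := by ring
    rw [hWsucc, hring]
    linarith
  have hW0 : W 0 = Fintype.card V := by simp [hW, hw, hc]
  have hWle : ∀ i : ℕ, i ≤ t → W i ≤ Fintype.card V * (1 + δ / z) ^ i := by
    intro i
    induction i with
    | zero => intro _; simp [hW0]
    | succ k ih =>
      intro hk
      calc W (k + 1) ≤ W k * (1 + δ / z) := hWstep ⟨k, hk⟩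
        _ ≤ Fintype.card V * (1 + δ / z) ^ k * (1 + δ / z) :=
          mul_le_mul_of_nonneg_right (ih (by omega)) (by positivity)
        _ = Fintype.card V * (1 + δ / z) ^ (k + 1) := by ring
  have hn0 : (0 : ℝ) < Fintype.card V := by exact_mod_cast (by omega : 0 < Fintype.card V)
  have hwW : ∀ v, w t v ≤ W t := fun v => by
    rw [hW]
    exact single_le_sum (f := w t) (fun u _ => (hwpos t u).le) (mem_univ v)
  have hlog : ∀ v, c t v * Real.log (1 + δ)
      ≤ Real.log (Fintype.card V) + t * (δ / ((1 + δ) * zstar)) := by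
    intro v
    have hδz : δ / z ≤ δ / ((1 + δ) * zstar) :=
      div_le_div_of_nonneg_left hδ.le (by positivity) hzz
    have hfac : Real.log (1 + δ / z) ≤ δ / z := by
      have := Real.log_le_sub_one_of_pos (x := 1 + δ / z) (by positivity)
      linarith
    calc c t v * Real.log (1 + δ) = Real.log (w t v) := by rw [hw, Real.log_pow]
      _ ≤ Real.log (Fintype.card V * (1 + δ / z) ^ t) :=
        Real.log_le_log (hwpos t v) ((hwW v).trans (hWle t le_rfl))
      _ = Real.log (Fintype.card V) + t * Real.log (1 + δ / z) := by
        rw [Real.log_mul hn0.ne' (by positivity), Real.log_pow]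
      _ ≤ _ := by gcongr; exact hfac.trans hδz
  have hcover : (t : ℝ) ≤ ∑ v, xstar v * c t v := by
    have hct : ∀ v, xstar v * c t v
        = ∑ j : Fin t, if (e j).1 = v ∨ (e j).2 = v then xstar v else 0 := by
      intro v
      simp [hc, ← sum_filter, mul_comm]
    rw [sum_congr rfl fun v _ => hct v, sum_comm]
    calc (t : ℝ) = ∑ _j : Fin t, (1 : ℝ) := by simp
      _ ≤ _ := sum_le_sum fun j _ => by
        rw [sum_ite_eq_or_eq (he j).ne]
        exact hxstar.2 _ _ (he j)
  have hgap := div_one_add_lt_log_one_add hδ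
  have hlog0 : 0 ≤ Real.log (1 + δ) := Real.log_nonneg (by linarith)
  rw [le_div_iff₀ (by linarith)]
  have hmain : t * Real.log (1 + δ)
      ≤ zstar * (Real.log (Fintype.card V) + t * (δ / ((1 + δ) * zstar))) := by
    calc t * Real.log (1 + δ) ≤ (∑ v, xstar v * c t v) * Real.log (1 + δ) :=
          mul_le_mul_of_nonneg_right hcover hlog0
      _ = ∑ v, xstar v * (c t v * Real.log (1 + δ)) := by
        rw [sum_mul]
        exact sum_congr rfl fun v _ => by ring
      _ ≤ ∑ v, xstar v * (Real.log (Fintype.card V) + t * (δ / ((1 + δ) * zstar))) :=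
        sum_le_sum fun v _ => mul_le_mul_of_nonneg_left (hlog v) (hxstar.1 v).1
      _ = _ := by rw [← sum_mul, hsize]
  have hcancel : zstar * (Real.log (Fintype.card V) + t * (δ / ((1 + δ) * zstar)))
      = zstar * Real.log (Fintype.card V) + t * (δ / (1 + δ)) := by
    field_simp
  rw [hcancel] at hmain
  linarith
end

section
/- Let G = (V,E) be a finite simple graph, let x : V → [0,1] be a fractional vertex cover of G, let X* ⊆ V be a vertex cover of G, and let α, λ > 0 with α + λ ≤ 1/2. Define H = {v ∈ V : x_v > 1−α}, L = {v ∈ V : x_v < α}, and L′ = {v ∈ V : α ≤ x_v < α+λ}. Define x′ : V → ℝ by x′_v = x_v − λ if v ∈ H∖X*, x′_v = x_v + λ if v ∈ (L∪L′)∩X*, and x′_v = x_v otherwise. Then x′ takes values in [0,1] and is a fractional vertex cover of G. -/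
/-- The modified solution in the kernel analysis: given a fractional vertex
cover `x`, a vertex cover `X*`, and `α, λ > 0` with `α + λ ≤ 1/2`, the function
`x'` obtained by decreasing `x` by `λ` on `H∖X*` and increasing it by `λ` on
`(L ∪ L′) ∩ X*` (where `H = {x > 1−α}`, `L = {x < α}`, `L′ = {α ≤ x < α+λ}`)
is again a fractional vertex cover (in particular takes values in `[0,1]`). -/
theorem stmt8 {V : Type*} [Fintype V] (G : SimpleGraph V)
    (x : V → ℝ) (hx : IsFracVC G x)
    (Xstar : Set V) (hXstar : ∀ u v, G.Adj u v → u ∈ Xstar ∨ v ∈ Xstar)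
    (α lam : ℝ) (hα : 0 < α) (hlam : 0 < lam) (hαlam : α + lam ≤ 1 / 2)
    (H L L' : Set V)
    (hH : H = {v | 1 - α < x v}) (hL : L = {v | x v < α})
    (hL' : L' = {v | α ≤ x v ∧ x v < α + lam})
    (x' : V → ℝ)
    (hx'H : ∀ v ∈ H \ Xstar, x' v = x v - lam)
    (hx'L : ∀ v ∈ (L ∪ L') ∩ Xstar, x' v = x v + lam)
    (hx'other : ∀ v, v ∉ H \ Xstar → v ∉ (L ∪ L') ∩ Xstar → x' v = x v) :
    IsFracVC G x' := by
  have key : ∀ v, (v ∉ Xstar ∧ 1 - α < x v ∧ x' v = x v - lam) ∨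
      (v ∈ Xstar ∧ x v < α + lam ∧ x' v = x v + lam) ∨
      (x' v = x v ∧ (v ∈ Xstar → α + lam ≤ x v)) := by
    intro v
    have h₁ := hx'H v
    have h₂ := hx'L v
    have h₃ := hx'other v
    simp only [hH, hL, hL', Set.mem_sdiff, Set.mem_inter_iff, Set.mem_union,
      Set.mem_ofPred_eq] at h₁ h₂ h₃
    grind
  obtain ⟨hbound, hedge⟩ := hx
  refine ⟨fun v => ?_, fun u v huv => ?_⟩
  · obtain ⟨h0, h1⟩ := hbound v
    rcases key v with ⟨_, h, e⟩ | ⟨_, h, e⟩ | ⟨e, _⟩ <;> constructor <;> linarith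
  · have he := hedge u v huv
    have hc := hXstar u v huv
    rcases key u with ⟨hu, h, e⟩ | ⟨hu, h, e⟩ | ⟨e, hu⟩ <;>
      rcases key v with ⟨hv, h', e'⟩ | ⟨hv, h', e'⟩ | ⟨e', hv⟩ <;> grind
end

section
/- Let G = (V,E) be a finite simple graph, let x : V → [0,1] be a fractional vertex cover of G, let X* ⊆ V be a vertex cover of G, and let α, λ > 0 with α + λ ≤ 1/2. Define H = {v ∈ V : x_v > 1−α}, L = {v ∈ V : x_v < α}, and L′ = {v ∈ V : α ≤ x_v < α+λ}. Let f* denote the minimum size of a fractional vertex cover of G. Then |H∖X*| ≤ |L∩X*| + |L′∩X*| + (Σ_{v∈V} x_v − f*)/λ. -/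
/-- The size of a minimum fractional vertex cover is at most that of any other. -/
theorem IsFracVC.sInf_le_sum {V : Type*} [Fintype V] {G : SimpleGraph V} {y : V → ℝ}
    (hy : IsFracVC G y) :
    sInf {r : ℝ | ∃ y : V → ℝ, IsFracVC G y ∧ ∑ v, y v = r} ≤ ∑ v, y v := by
  refine csInf_le ⟨0, ?_⟩ ⟨y, hy, rfl⟩
  rintro r ⟨z, hz, rfl⟩
  exact Finset.sum_nonneg fun v _ => (hz.1 v).1

theorem sum_indicator_const_eq_ncard_mul {V : Type*} [Fintype V] (S : Set V) (c : ℝ) :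
    ∑ v, S.indicator (fun _ => c) v = S.ncard * c := by
  classical
  rw [Set.ncard_eq_toFinset_card']
  simp only [Set.indicator_apply, ← Finset.sum_filter, Set.filter_mem_univ_eq_toFinset,
    Finset.sum_const, nsmul_eq_mul]

/-- Kernel counting bound: for a fractional vertex cover `x`, a vertex cover
`X*`, and `α, λ > 0` with `α + λ ≤ 1/2`, setting `H = {x > 1−α}`,
`L = {x < α}`, `L′ = {α ≤ x < α+λ}`, and letting `f*` denote the minimum size
of a fractional vertex cover of `G`, one has
`|H∖X*| ≤ |L∩X*| + |L′∩X*| + (Σ_v x v − f*)/λ`. -/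
theorem stmt9 {V : Type*} [Fintype V] (G : SimpleGraph V)
    (x : V → ℝ) (hx : IsFracVC G x)
    (Xstar : Set V) (hXstar : ∀ u v, G.Adj u v → u ∈ Xstar ∨ v ∈ Xstar)
    (α lam : ℝ) (hα : 0 < α) (hlam : 0 < lam) (hαlam : α + lam ≤ 1 / 2)
    (H L L' : Set V)
    (hH : H = {v | 1 - α < x v}) (hL : L = {v | x v < α})
    (hL' : L' = {v | α ≤ x v ∧ x v < α + lam})
    (fstar : ℝ)
    (hfstar : fstar = sInf {r : ℝ | ∃ y : V → ℝ, IsFracVC G y ∧ ∑ v, y v = r}) :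
    ((H \ Xstar).ncard : ℝ) ≤
      (L ∩ Xstar).ncard + (L' ∩ Xstar).ncard + (∑ v, x v - fstar) / lam := by
  subst hH hL hL'
  set A : Set V := {v | 1 - α < x v} \ Xstar with hA
  set B : Set V := {v | x v < α} ∩ Xstar with hB
  set C : Set V := {v | α ≤ x v ∧ x v < α + lam} ∩ Xstar with hC
  let y : V → ℝ := fun v => x v - A.indicator (fun _ => lam) v +
    B.indicator (fun _ => lam) v + C.indicator (fun _ => lam) v
  have hyc : IsFracVC G y := by
    classical
    refine ⟨fun v => ?_, fun u v huv => ?_⟩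
    · have hv := hx.1 v
      simp only [y, hA, hB, hC, Set.indicator_apply, Set.mem_sdiff, Set.mem_inter_iff,
        Set.mem_ofPred_eq]
      constructor <;> split_ifs <;> grind
    · have hu := hx.1 u
      have hv := hx.1 v
      have hsum := hx.2 u v huv
      have hcov := hXstar u v huv
      simp only [y, hA, hB, hC, Set.indicator_apply, Set.mem_sdiff, Set.mem_inter_iff,
        Set.mem_ofPred_eq]
      split_ifs <;> grind
  have hle := hyc.sInf_le_sum
  rw [← hfstar] at hle
  simp only [y, Finset.sum_add_distrib, Finset.sum_sub_distrib,
    sum_indicator_const_eq_ncard_mul] at hle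
  rw [← sub_le_iff_le_add', le_div_iff₀ hlam]
  linarith
end

section
/- Let G = (V,E) be a finite simple graph, let x : V → [0,1] be a fractional vertex cover of G, let 0 < α < 1/2, and let c ≥ 1. Define L = {v ∈ V : x_v < α}, K = {v ∈ V : α ≤ x_v ≤ 1−α}, and H = {v ∈ V : x_v > 1−α}. Let X* be any vertex cover of G, and let X_K be a vertex cover of the induced subgraph G[K] such that |X_K| ≤ c·|Y| for every vertex cover Y of G[K]. Then X_K ∪ H is a vertex cover of G and |X_K ∪ H| ≤ c·(|X*| + |H∖X*| − |L∩X*|). -/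
/-- Kernelization bound: with `L = {x < α}`, `K = {α ≤ x ≤ 1−α}`,
`H = {x > 1−α}` for a fractional vertex cover `x` and `0 < α < 1/2`, if `X_K`
is a vertex cover of the induced subgraph `G[K]` that is a `c`-approximation of
the minimum vertex cover of `G[K]`, then for any vertex cover `X*` of `G`, the
set `X_K ∪ H` is a vertex cover of `G` of size at most
`c·(|X*| + |H∖X*| − |L∩X*|)`. -/
theorem stmt10 {V : Type*} [Fintype V] (G : SimpleGraph V)
    (x : V → ℝ) (hx : IsFracVC G x)
    (α : ℝ) (hα : 0 < α) (hα2 : α < 1 / 2) (c : ℝ) (hc : 1 ≤ c)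
    (L K H : Set V)
    (hL : L = {v | x v < α}) (hK : K = {v | α ≤ x v ∧ x v ≤ 1 - α})
    (hH : H = {v | 1 - α < x v})
    (Xstar : Set V) (hXstar : ∀ u v, G.Adj u v → u ∈ Xstar ∨ v ∈ Xstar)
    (XK : Set V) (hXKsub : XK ⊆ K)
    (hXK : ∀ u v, G.Adj u v → u ∈ K → v ∈ K → u ∈ XK ∨ v ∈ XK)
    (hXKapx : ∀ Y : Set V, Y ⊆ K →
      (∀ u v, G.Adj u v → u ∈ K → v ∈ K → u ∈ Y ∨ v ∈ Y) →
      (XK.ncard : ℝ) ≤ c * Y.ncard) :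
    (∀ u v, G.Adj u v → u ∈ XK ∪ H ∨ v ∈ XK ∪ H) ∧
      ((XK ∪ H).ncard : ℝ) ≤
        c * (Xstar.ncard + (H \ Xstar).ncard - (L ∩ Xstar).ncard) := by
  subst hL hK hH
  set L : Set V := {v | x v < α}
  set K : Set V := {v | α ≤ x v ∧ x v ≤ 1 - α}
  set H : Set V := {v | 1 - α < x v}
  have cases_LKH (v : V) : v ∈ L ∨ v ∈ K ∨ v ∈ H := by
    simp only [L, K, H, Set.mem_ofPred_eq]
    grind
  constructor
  · intro u v huv
    have hsum := hx.2 u v huv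
    rcases cases_LKH u with hu | hu | hu
    · refine .inr (.inr ?_)
      simp only [L, H, Set.mem_ofPred_eq] at hu ⊢
      linarith
    · rcases cases_LKH v with hv | hv | hv
      · refine .inl (.inr ?_)
        simp only [L, H, Set.mem_ofPred_eq] at hv ⊢
        linarith
      · exact (hXK u v huv hu hv).imp .inl .inl
      · exact .inr (.inr hv)
    · exact .inl (.inr hu)
  · have hXK_le : (XK.ncard : ℝ) ≤ c * (K ∩ Xstar).ncard :=
      hXKapx _ Set.inter_subset_left fun u v huv hu hv =>
        (hXstar u v huv).imp (fun h => ⟨hu, h⟩) (fun h => ⟨hv, h⟩)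
    have hunion : ((XK ∪ H).ncard : ℝ) ≤ XK.ncard + H.ncard :=
      mod_cast Set.ncard_union_le XK H
    have hH_card : ((H ∩ Xstar).ncard : ℝ) + (H \ Xstar).ncard = H.ncard :=
      mod_cast Set.ncard_inter_add_ncard_sdiff_eq_ncard H Xstar
    have hKH : Disjoint (K ∩ Xstar) (H ∩ Xstar) :=
      Set.disjoint_left.2 fun v hvK hvH => not_lt_of_ge hvK.1.2 hvH.1
    have hdiff : Xstar \ L = K ∩ Xstar ∪ H ∩ Xstar := by
      ext v
      have := cases_LKH v
      simp only [L, K, H, Set.mem_ofPred_eq, Set.mem_sdiff, Set.mem_union, Set.mem_inter_iff] at this ⊢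
      grind
    have hXstar_card :
        ((L ∩ Xstar).ncard : ℝ) + ((K ∩ Xstar).ncard + (H ∩ Xstar).ncard) = Xstar.ncard := by
      rw [← Set.ncard_inter_add_ncard_sdiff_eq_ncard Xstar L, hdiff, Set.ncard_union_eq hKH,
        Set.inter_comm Xstar L]
      push_cast
      rfl
    have hH_le : (H.ncard : ℝ) ≤ c * H.ncard := le_mul_of_one_le_left (by positivity) hc
    calc ((XK ∪ H).ncard : ℝ) ≤ c * (K ∩ Xstar).ncard + c * H.ncard := by linarith
      _ = c * (Xstar.ncard + (H \ Xstar).ncard - (L ∩ Xstar).ncard) := by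
        rw [← hXstar_card, ← hH_card]
        ring
end

section
/- Let d ≥ 1 and let c, Δ be positive integers. Let F be a finite family of pairwise distinct, nonempty, bounded subsets of ℝ^d that is c-fat, and suppose every point of ℝ^d lies in at most Δ members of F. Then every nonempty subfamily G ⊆ F contains a member s that intersects at most cΔ other members of G (i.e., the intersection graph of F is cΔ-degenerate), and consequently the intersection graph of F — the simple graph whose vertices are the members of F, with two distinct members adjacent iff they intersect — admits a proper coloring with cΔ+1 colors. -/
open Classical

/-- A family of subsets of `ℝ^d` (equipped with the sup metric, so that closed
balls are axis-aligned hypercubes and `Metric.diam` is the `L∞`-diameter) is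
`c`-fat if for every axis-aligned closed hypercube `B` there exist at most `c`
points piercing every member of the family that intersects `B` and has diameter
at least `diam B`. -/
def IsCFat {d : ℕ} (c : ℕ) (F : Set (Set (Fin d → ℝ))) : Prop :=
  ∀ (z : Fin d → ℝ) (r : ℝ), 0 ≤ r →
    ∃ P : Finset (Fin d → ℝ), P.card ≤ c ∧
      ∀ s ∈ F, (s ∩ Metric.closedBall z r).Nonempty →
        Metric.diam (Metric.closedBall z r) ≤ Metric.diam s → ∃ p ∈ P, p ∈ s

/-- A bounded set in `ℝ^d` with the sup metric lies in a closed ball of half its diameter. -/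
theorem Bornology.IsBounded.exists_subset_closedBall_half_diam {ι : Type*} [Fintype ι]
    {s : Set (ι → ℝ)} (hs : Bornology.IsBounded s) :
    ∃ z, s ⊆ Metric.closedBall z (Metric.diam s / 2) := by
  refine ⟨fun i => (sInf (Function.eval i '' s) + sSup (Function.eval i '' s)) / 2, fun x hx => ?_⟩
  rw [Metric.mem_closedBall, dist_pi_le_iff (by positivity)]
  intro i
  have himage : Bornology.IsBounded (Function.eval i '' s) :=
    (LipschitzWith.eval i).isBounded_image hs
  have hdiam : Metric.diam (Function.eval i '' s) ≤ Metric.diam s := by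
    refine Metric.diam_le_of_forall_dist_le Metric.diam_nonneg ?_
    rintro _ ⟨a, ha, rfl⟩ _ ⟨b, hb, rfl⟩
    exact (dist_le_pi_dist a b i).trans (Metric.dist_le_diam_of_mem hs ha hb)
  rw [Real.diam_eq himage] at hdiam
  have hle : x i ≤ sSup (Function.eval i '' s) := le_csSup himage.bddAbove ⟨x, hx, rfl⟩
  have hge : sInf (Function.eval i '' s) ≤ x i := csInf_le himage.bddBelow ⟨x, hx, rfl⟩
  rw [Real.dist_eq, abs_le]
  constructor <;> linarith

/-- In a fat family of bounded depth, a member of smallest diameter meets few members. -/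
theorem IsCFat.card_filter_inter_le {d c Δ : ℕ} {F : Finset (Set (Fin d → ℝ))}
    (hfat : IsCFat c (↑F : Set (Set (Fin d → ℝ))))
    (hdepth : ∀ p : Fin d → ℝ, (F.filter (fun s => p ∈ s)).card ≤ Δ)
    {G : Finset (Set (Fin d → ℝ))} (hG : G ⊆ F) {s : Set (Fin d → ℝ)}
    (hs : Bornology.IsBounded s) (hmin : ∀ t ∈ G, Metric.diam s ≤ Metric.diam t) :
    (G.filter (fun t => (s ∩ t).Nonempty)).card ≤ c * Δ := by
  obtain ⟨z, hz⟩ := hs.exists_subset_closedBall_half_diam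
  have hr : 0 ≤ Metric.diam s / 2 := by positivity
  obtain ⟨P, hPc, hP⟩ := hfat z _ hr
  have hball : Metric.diam (Metric.closedBall z (Metric.diam s / 2)) ≤ Metric.diam s :=
    (Metric.diam_closedBall hr).trans (by linarith)
  have hsub : G.filter (fun t => (s ∩ t).Nonempty) ⊆
      P.biUnion (fun p => F.filter (fun t => p ∈ t)) := by
    intro t ht
    obtain ⟨htG, x, hxs, hxt⟩ := Finset.mem_filter.1 ht
    obtain ⟨p, hp, hpt⟩ := hP t (hG htG) ⟨x, hxt, hz hxs⟩ (hball.trans (hmin t htG))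
    exact Finset.mem_biUnion.2 ⟨p, hp, Finset.mem_filter.2 ⟨hG htG, hpt⟩⟩
  calc _ ≤ _ := Finset.card_le_card hsub
    _ ≤ P.card * Δ := Finset.card_biUnion_le_card_mul _ _ _ fun p _ => hdepth p
    _ ≤ c * Δ := Nat.mul_le_mul_right _ hPc

/-- Greedy coloring: a finite `k`-degenerate symmetric relation is properly `(k + 1)`-colorable. -/
theorem exists_proper_coloring_of_degenerate {α : Type*} {r : α → α → Prop}
    (hr : ∀ a b, r a b → r b a) {k : ℕ} (F : Finset α)
    (h : ∀ G ⊆ F, G.Nonempty → ∃ s ∈ G, (G.filter (fun t => t ≠ s ∧ r s t)).card ≤ k) :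
    ∃ f : α → Fin (k + 1), ∀ s ∈ F, ∀ t ∈ F, s ≠ t → r s t → f s ≠ f t := by
  induction F using Finset.strongInduction with
  | H F ih =>
    rcases F.eq_empty_or_nonempty with rfl | hF
    · exact ⟨fun _ => 0, by simp⟩
    obtain ⟨a, ha, hcard⟩ := h F subset_rfl hF
    obtain ⟨f, hf⟩ := ih (F.erase a) (Finset.erase_ssubset ha)
      fun G hG => h G (hG.trans (Finset.erase_subset a F))
    obtain ⟨col, hcol⟩ : ∃ col, col ∉ (F.filter (fun t => t ≠ a ∧ r a t)).image f := by
      by_contra! hall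
      have hle := Finset.card_le_card (fun col _ => hall col : Finset.univ ⊆ _)
      have himage := (hle.trans Finset.card_image_le).trans hcard
      simp at himage
    have hne : ∀ t ∈ F, t ≠ a → r a t → f t ≠ col := fun t ht hta hat heq =>
      hcol (Finset.mem_image.2 ⟨t, Finset.mem_filter.2 ⟨ht, hta, hat⟩, heq⟩)
    refine ⟨Function.update f a col, fun s hs t ht hst hrel => ?_⟩
    rcases eq_or_ne s a with rfl | hsa
    · rw [Function.update_self, Function.update_of_ne hst.symm]
      exact (hne t ht hst.symm hrel).symm
    rcases eq_or_ne t a with rfl | hta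
    · rw [Function.update_self, Function.update_of_ne hsa]
      exact hne s hs hsa (hr _ _ hrel)
    · rw [Function.update_of_ne hsa, Function.update_of_ne hta]
      exact hf s (Finset.mem_erase.2 ⟨hsa, hs⟩) t (Finset.mem_erase.2 ⟨hta, ht⟩) hst hrel

/-- If `F` is a finite `c`-fat family of (pairwise distinct) nonempty bounded
subsets of `ℝ^d` in which every point has depth at most `Δ`, then every
nonempty subfamily `G ⊆ F` has a member intersecting at most `c·Δ` other
members of `G` (the intersection graph is `c·Δ`-degenerate), and consequently
the intersection graph of `F` is properly `(c·Δ+1)`-colorable. -/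
theorem stmt11 (d : ℕ) (hd : 1 ≤ d) (c Δ : ℕ) (hc : 0 < c) (hΔ : 0 < Δ)
    (F : Finset (Set (Fin d → ℝ)))
    (hne : ∀ s ∈ F, s.Nonempty) (hbdd : ∀ s ∈ F, Bornology.IsBounded s)
    (hfat : IsCFat c (↑F : Set (Set (Fin d → ℝ))))
    (hdepth : ∀ p : Fin d → ℝ, (F.filter (fun s => p ∈ s)).card ≤ Δ) :
    (∀ G ⊆ F, G.Nonempty → ∃ s ∈ G,
        (G.filter (fun t => t ≠ s ∧ (s ∩ t).Nonempty)).card ≤ c * Δ) ∧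
      ∃ f : Set (Fin d → ℝ) → Fin (c * Δ + 1),
        ∀ s ∈ F, ∀ t ∈ F, s ≠ t → (s ∩ t).Nonempty → f s ≠ f t := by
  have hdeg : ∀ G ⊆ F, G.Nonempty → ∃ s ∈ G,
      (G.filter (fun t => t ≠ s ∧ (s ∩ t).Nonempty)).card ≤ c * Δ := by
    intro G hG hGne
    obtain ⟨s, hsG, hmin⟩ := G.exists_min_image Metric.diam hGne
    refine ⟨s, hsG, le_trans (Finset.card_le_card ?_)
      (hfat.card_filter_inter_le hdepth hG (hbdd s (hG hsG)) hmin)⟩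
    exact Finset.monotone_filter_right _ fun _ _ ht => ht.2
  exact ⟨hdeg, exists_proper_coloring_of_degenerate (r := fun s t => (s ∩ t).Nonempty)
    (fun s t hst => by rwa [Set.inter_comm]) F hdeg⟩
end

section
/- Let n, ℓ ≥ 1 be integers. Let H be a family of functions h : {1,…,n} → {1,…,ℓ} with the property that for every subset S ⊆ {1,…,n} with |S| ≤ ℓ there exists h ∈ H that is injective on S. Then there exists a family Z of subsets of {1,…,n} with |Z| ≤ |H|·2^ℓ such that for all disjoint sets A, B ⊆ {1,…,n} with |A| + |B| ≤ ℓ, there exists Z ∈ Z with A ⊆ Z and B ⊆ {1,…,n}∖Z. -/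
/-- From an `ℓ`-perfect hash family `H` of functions `{1,…,n} → {1,…,ℓ}` one
obtains a separating family `Z` of at most `|H|·2^ℓ` subsets of `{1,…,n}`:
for all disjoint `A, B` with `|A| + |B| ≤ ℓ` some `Z' ∈ Z` contains `A` and
avoids `B`. -/
theorem stmt12 (n ℓ : ℕ) (hn : 1 ≤ n) (hℓ : 1 ≤ ℓ)
    (H : Finset (Fin n → Fin ℓ))
    (hH : ∀ S : Finset (Fin n), S.card ≤ ℓ → ∃ h ∈ H, Set.InjOn h ↑S) :
    ∃ Z : Finset (Finset (Fin n)), Z.card ≤ H.card * 2 ^ ℓ ∧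
      ∀ A B : Finset (Fin n), Disjoint A B → A.card + B.card ≤ ℓ →
        ∃ Z' ∈ Z, A ⊆ Z' ∧ ∀ b ∈ B, b ∉ Z' := by
  refine ⟨(H ×ˢ (Finset.univ : Finset (Finset (Fin ℓ)))).image
    fun p => Finset.univ.filter fun v => p.1 v ∈ p.2, ?_, ?_⟩
  · refine Finset.card_image_le.trans (le_of_eq ?_)
    simp [Finset.card_product]
  · intro A B hAB hcard
    obtain ⟨h, hmem, hinj⟩ := hH (A ∪ B) ((Finset.card_union_le A B).trans hcard)
    refine ⟨_, Finset.mem_image_of_mem _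
      (Finset.mk_mem_product hmem (Finset.mem_univ (A.image h))), ?_, ?_⟩
    · intro a ha
      simpa using ⟨a, ha, rfl⟩
    · intro b hb hbZ
      obtain ⟨a, ha, hab⟩ := Finset.mem_image.mp (Finset.mem_filter.mp hbZ).2
      have hEq : a = b := hinj (Finset.mem_coe.mpr (Finset.mem_union_left B ha))
        (Finset.mem_coe.mpr (Finset.mem_union_right A hb)) hab
      exact Finset.disjoint_left.mp hAB ha (hEq ▸ hb)
end

section
/- Let G be a finite simple bipartite graph, i.e., its vertex set admits a partition V = A ⊔ B such that every edge joins a vertex of A to a vertex of B. Let M be a matching in G and let ℓ ≥ 1. Suppose M admits no augmenting path of length 2k+1 for any k with 2k+1 ≤ 2ℓ−1. Let v_0, u_1, v_1, u_2, v_2, …, u_ℓ, v_ℓ, u_{ℓ+1} be vertices of G (not assumed distinct) such that v_0 and u_{ℓ+1} are unmatched, {v_{i−1}, u_i} is an edge of G not in M for i = 1,…,ℓ+1, and {u_i, v_i} ∈ M for i = 1,…,ℓ. Then these 2ℓ+2 vertices are pairwise distinct; in particular, the walk v_0 u_1 v_1 ⋯ u_ℓ v_ℓ u_{ℓ+1}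 is an augmenting path of M of length 2ℓ+1. -/
/-- `M` is a matching in the simple graph `G`: a set of edges of `G`, no two of
which share a vertex. -/
def IsMatchingIn {V : Type*} (G : SimpleGraph V) (M : Set (Sym2 V)) : Prop :=
  M ⊆ G.edgeSet ∧ ∀ e ∈ M, ∀ f ∈ M, e ≠ f → ∀ v, v ∈ e → v ∉ f

/-- `p 0, p 1, …, p (2k+1)` is an augmenting path of the matching `M` of length
`2k+1` in `G`: the listed vertices are distinct, consecutive vertices are
adjacent, the edges `{p (2i), p (2i+1)}` are not in `M`, the edges
`{p (2i+1), p (2i+2)}` are in `M`, and `p 0` and `p (2k+1)` are unmatched. -/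
def IsAugPath {V : Type*} (G : SimpleGraph V) (M : Set (Sym2 V)) (k : ℕ)
    (p : ℕ → V) : Prop :=
  (∀ i ≤ 2 * k + 1, ∀ j ≤ 2 * k + 1, p i = p j → i = j) ∧
  (∀ i < 2 * k + 1, G.Adj (p i) (p (i + 1))) ∧
  (∀ i ≤ k, s(p (2 * i), p (2 * i + 1)) ∉ M) ∧
  (∀ i < k, s(p (2 * i + 1), p (2 * i + 2)) ∈ M) ∧
  (¬ ∃ e ∈ M, p 0 ∈ e) ∧ (¬ ∃ e ∈ M, p (2 * k + 1) ∈ e)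

/-- In a matching, the partner of a vertex is unique. -/
theorem IsMatchingIn.partner_unique {V : Type*} {G : SimpleGraph V} {M : Set (Sym2 V)}
    (hM : IsMatchingIn G M) {x a b : V} (ha : s(x, a) ∈ M) (hb : s(x, b) ∈ M) : a = b := by
  by_contra hab
  exact hM.2 _ ha _ hb (fun h => hab (Sym2.congr_right.mp h)) x
    (Sym2.mem_mk_left x a) (Sym2.mem_mk_left x b)

/-- In a bipartite graph without augmenting paths of length less than `2n+1`, every augmenting
walk of length `2n+1` is an augmenting path. -/
theorem isAugPath_of_walk {V : Type*} (G : SimpleGraph V) (A : Set V)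
    (hbip : ∀ u v, G.Adj u v → (u ∈ A ↔ v ∉ A))
    (M : Set (Sym2 V)) (hM : IsMatchingIn G M) (n : ℕ)
    (hshort : ∀ k < n, ∀ q : ℕ → V, ¬ IsAugPath G M k q)
    (v u : ℕ → V)
    (hv0 : ¬ ∃ e ∈ M, v 0 ∈ e)
    (hu : ¬ ∃ e ∈ M, u (n + 1) ∈ e)
    (hadj : ∀ i ≤ n, G.Adj (v i) (u (i + 1)) ∧ s(v i, u (i + 1)) ∉ M)
    (hmatch : ∀ i, 1 ≤ i → i ≤ n → s(u i, v i) ∈ M) :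
    IsAugPath G M n (fun j => if j % 2 = 0 then v (j / 2) else u (j / 2 + 1)) := by
  induction n using Nat.strong_induction_on generalizing v u with
  | _ n ih =>
  have v_ne : ∀ i j, i < j → j ≤ n → v i ≠ v j := by
    intro i j hij hj h
    rcases Nat.eq_zero_or_pos i with rfl | hi
    · exact hv0 ⟨_, hmatch j hij hj, h ▸ Sym2.mem_mk_right _ _⟩
    · refine hshort (n - (j - i)) (by omega) _ (ih (n - (j - i)) (by omega)
        (fun k hk => hshort k (by omega))
        (fun t => if t ≤ i then v t else v (t + (j - i)))
        (fun t => if t ≤ i then u t else u (t + (j - i))) ?_ ?_ ?_ ?_)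
      · simpa using hv0
      · have h1 : ¬ n - (j - i) + 1 ≤ i := by omega
        have h2 : n - (j - i) + 1 + (j - i) = n + 1 := by omega
        simpa only [h1, if_false, h2] using hu
      · intro t ht
        rcases lt_trichotomy t i with hti | rfl | hti
        · simpa only [hti.le, Nat.succ_le_of_lt hti, if_true] using hadj t (by omega)
        · have h1 : ¬ t + 1 ≤ t := by omega
          have h2 : t + 1 + (j - t) = j + 1 := by omega
          simpa only [le_refl, h1, if_true, if_false, h2, h] using hadj j hj
        · have h1 : ¬ t ≤ i := by omega
          have h2 : ¬ t + 1 ≤ i := by omega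
          have h3 : t + 1 + (j - i) = t + (j - i) + 1 := by omega
          simpa only [h1, h2, if_false, h3] using hadj (t + (j - i)) (by omega)
      · intro t ht ht'
        by_cases hti : t ≤ i
        · simpa only [hti, if_true] using hmatch t ht (by omega)
        · simpa only [hti, if_false] using hmatch (t + (j - i)) (by omega) (by omega)
  have u_ne : ∀ i j, i < j → j ≤ n → u (i + 1) ≠ u (j + 1) := by
    intro i j hij hj h
    have hi := hmatch (i + 1) (by omega) (by omega)
    rcases hj.eq_or_lt with rfl | hj
    · exact hu ⟨_, hi, h ▸ Sym2.mem_mk_left _ _⟩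
    · have hj' := hmatch (j + 1) (by omega) (by omega)
      rw [← h] at hj'
      exact v_ne (i + 1) (j + 1) (by omega) hj (hM.partner_unique hi hj')
  have v_side : ∀ i ≤ n, (v i ∈ A ↔ v 0 ∈ A) := by
    intro i
    induction i with
    | zero => simp
    | succ i hi =>
      intro h
      have h1 := hi (by omega)
      have h2 := hbip _ _ (hadj i (by omega)).1
      have h3 := hbip _ _ (G.mem_edgeSet.mp (hM.1 (hmatch (i + 1) (by omega) h)))
      tauto
  have v_ne_u : ∀ i ≤ n, ∀ j ≤ n, v i ≠ u (j + 1) := by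
    intro i hi j hj h
    have h1 := hbip _ _ (hadj j hj).1
    have h2 := v_side i hi
    have h3 := v_side j hj
    rw [h] at h2
    tauto
  have v_inj : ∀ i ≤ n, ∀ j ≤ n, v i = v j → i = j := fun i hi j hj h => by
    rcases lt_trichotomy i j with hij | hij | hij
    exacts [absurd h (v_ne i j hij hj), hij, absurd h.symm (v_ne j i hij hi)]
  have u_inj : ∀ i ≤ n, ∀ j ≤ n, u (i + 1) = u (j + 1) → i = j := fun i hi j hj h => by
    rcases lt_trichotomy i j with hij | hij | hij
    exacts [absurd h (u_ne i j hij hj), hij, absurd h.symm (u_ne j i hij hi)]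
  have even_mod (i : ℕ) : 2 * i % 2 = 0 := by omega
  have even_div (i : ℕ) : 2 * i / 2 = i := by omega
  have odd_mod (i : ℕ) : ¬ (2 * i + 1) % 2 = 0 := by omega
  have odd_div (i : ℕ) : (2 * i + 1) / 2 = i := by omega
  have next_mod (i : ℕ) : (2 * i + 2) % 2 = 0 := by omega
  have next_div (i : ℕ) : (2 * i + 2) / 2 = i + 1 := by omega
  refine ⟨?_, ?_, ?_, ?_, ?_, ?_⟩
  · intro i hi j hj h
    dsimp only at h
    split_ifs at h with h1 h2 h2
    · have := v_inj _ (by omega) _ (by omega) h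
      omega
    · exact absurd h (v_ne_u _ (by omega) _ (by omega))
    · exact absurd h.symm (v_ne_u _ (by omega) _ (by omega))
    · have := u_inj _ (by omega) _ (by omega) h
      omega
  · intro i hi
    obtain ⟨t, rfl | rfl⟩ : ∃ t, i = 2 * t ∨ i = 2 * t + 1 := ⟨i / 2, by omega⟩
    · simpa only [even_mod, even_div, odd_mod, odd_div, if_true, if_false]
        using (hadj t (by omega)).1
    · simpa only [odd_mod, odd_div, next_mod, next_div, add_assoc, Nat.reduceAdd, if_true,
        if_false] using G.mem_edgeSet.mp (hM.1 (hmatch (t + 1) (by omega) (by omega)))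
  · intro i hi
    simpa only [even_mod, even_div, odd_mod, odd_div, if_true, if_false] using (hadj i hi).2
  · intro i hi
    simpa only [odd_mod, odd_div, next_mod, next_div, if_true, if_false]
      using hmatch (i + 1) (by omega) (by omega)
  · simpa using hv0
  · simpa only [odd_mod, odd_div, if_false] using hu

/-- In a bipartite graph (with parts `A` and its complement), if a matching `M`
has no augmenting path of length `2k+1` for any `k` with `2k+1 ≤ 2ℓ−1`, then
every augmenting walk `v 0, u 1, v 1, …, u ℓ, v ℓ, u (ℓ+1)` of length `2ℓ+1`
(with `v 0` and `u (ℓ+1)` unmatched, the edges `{v (i-1), u i}` in `G` but not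
in `M`, and the edges `{u i, v i}` in `M`) has pairwise distinct vertices; in
particular, it is an augmenting path of `M` of length `2ℓ+1`. -/
theorem stmt14 {V : Type*} [Fintype V] (G : SimpleGraph V) (A : Set V)
    (hbip : ∀ u v, G.Adj u v → (u ∈ A ↔ v ∉ A))
    (M : Set (Sym2 V)) (hM : IsMatchingIn G M)
    (ℓ : ℕ) (hℓ : 1 ≤ ℓ)
    (hshort : ∀ k : ℕ, 2 * k + 1 ≤ 2 * ℓ - 1 → ∀ q : ℕ → V, ¬ IsAugPath G M k q)
    (v u : ℕ → V)
    (hv0 : ¬ ∃ e ∈ M, v 0 ∈ e)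
    (hu : ¬ ∃ e ∈ M, u (ℓ + 1) ∈ e)
    (hadj : ∀ i, 1 ≤ i → i ≤ ℓ + 1 →
      G.Adj (v (i - 1)) (u i) ∧ s(v (i - 1), u i) ∉ M)
    (hmatch : ∀ i, 1 ≤ i → i ≤ ℓ → s(u i, v i) ∈ M) :
    IsAugPath G M ℓ (fun j => if j % 2 = 0 then v (j / 2) else u (j / 2 + 1)) := by
  exact isAugPath_of_walk G A hbip M hM ℓ (fun k hk => hshort k (by omega)) v u hv0 hu
    (fun i hi => hadj (i + 1) (by omega) (by omega)) hmatch
end
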